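/- arXiv:2411.11298 — 3 statements merged into one kernel-verified Lean document; each statement's English description precedes it below -/
import Mathlib

section
/- For every nonempty string w, ρ(BBWT(w)) ≤ 2 · ρ(w). -/
/-! Basic definitions: strings as `List α`, rotations, runs, BWT, Lyndon
factorization, ω-order, bijective BWT, and Fibonacci words. -/

variable {α : Type*}

/-- Left cyclic rotation by one symbol. -/
def rot (x : List α) : List α := x.drop 1 ++ x.take 1

/-- The list of all `|x|` cyclic rotations of `x`. -/
def rotations (x : List α) : List (List α) :=
  (List.range x.length).map (fun i => rot^[i] x)

/-- ρ: the number of maximal runs of equal consecutive symbols. -/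
def runsCount [DecidableEq α] : List α → ℕ
  | [] => 0
  | [_] => 1
  | a :: b :: t => (if a = b then 0 else 1) + runsCount (b :: t)

/-- The Burrows–Wheeler transform: last symbols of the lexicographically
sorted rotations. -/
def BWT [LinearOrder α] (w : List α) : List α :=
  (List.insertionSort (· ≤ ·) (rotations w)).filterMap List.getLast?

/-- The lexicographically smallest rotation of `x`. -/
def lexMinRotation [LinearOrder α] (x : List α) : List α :=
  (List.insertionSort (· ≤ ·) (rotations x)).headD x

/-- A Lyndon word: nonempty and strictly smaller than all its proper rotations. -/
def IsLyndon [LinearOrder α] (x : List α) : Prop :=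
  x ≠ [] ∧ ∀ i < x.length, 0 < i → x < rot^[i] x

instance [LinearOrder α] : DecidablePred (IsLyndon (α := α)) := fun _ =>
  inferInstanceAs (Decidable (_ ∧ _))

/-- The longest prefix of `w` that is a Lyndon word (the first Lyndon factor). -/
def firstLyndonFactor [LinearOrder α] (w : List α) : List α :=
  (((List.range (w.length + 1)).map (fun i => w.take i)).filter
    (fun x => decide (IsLyndon x))).getLastD []

def lyndonFactAux [LinearOrder α] : ℕ → List α → List (List α)
  | 0, _ => []
  | _, [] => []
  | fuel+1, w =>
      let p := firstLyndonFactor w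
      if p.isEmpty then [] else p :: lyndonFactAux fuel (w.drop p.length)

/-- The Lyndon factorization of `w`: repeatedly peel off the longest Lyndon
prefix (equivalently, the unique nonincreasing factorization into Lyndon words). -/
def lyndonFactorization [LinearOrder α] (w : List α) : List (List α) :=
  lyndonFactAux w.length w

/-- `listPow x n = x^n`. -/
def listPow (x : List α) : ℕ → List α
  | 0 => []
  | n+1 => x ++ listPow x n

/-- ω-order: `x ≤ω y` iff `x^∞ ≤ y^∞` lexicographically; comparing the
equal-length words `x^{|y|}` and `y^{|x|}` is equivalent. -/
def omegaLE [LinearOrder α] (x y : List α) : Prop :=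
  listPow x y.length ≤ listPow y x.length

instance [LinearOrder α] : DecidableRel (omegaLE (α := α)) := fun _ _ =>
  inferInstanceAs (Decidable (_ ≤ _))

/-- The bijective Burrows–Wheeler transform: last symbols of all rotations of
all Lyndon factors of `w`, sorted in ω-order. -/
def BBWT [LinearOrder α] (w : List α) : List α :=
  (List.insertionSort omegaLE
    (((lyndonFactorization w).map rotations).flatten)).filterMap List.getLast?

/-- Fibonacci words over symbols `a < b`: `F 0 = b`, `F 1 = a`,
`F (i+2) = F (i+1) ++ F i`. -/
def fibWordG (a b : α) : ℕ → List α
  | 0 => [b]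
  | 1 => [a]
  | n+2 => fibWordG a b (n+1) ++ fibWordG a b n

/-- Fibonacci words over `Fin 2` with `a = 0 < b = 1`. -/
def fibWord : ℕ → List (Fin 2) := fibWordG 0 1

theorem runsCount_cons_cons [DecidableEq α] (a b : α) (t : List α) :
    runsCount (a :: b :: t) = (if a = b then 0 else 1) + runsCount (b :: t) := rfl

section LexSequences

variable [LinearOrder α]

/-- The sequence is smaller than the constant sequence of its first letter. -/
def IsFalling (s : Lex (ℕ → α)) : Prop := s < toLex (fun _ => ofLex s 0)

/-- The sequence is larger than the constant sequence of its first letter. -/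
def IsRising (s : Lex (ℕ → α)) : Prop := toLex (fun _ => ofLex s 0) < s

/-- The sequence is constant. -/
def IsSteady (s : Lex (ℕ → α)) : Prop := s = toLex (fun _ => ofLex s 0)

theorem isFalling_or_isSteady_or_isRising (s : Lex (ℕ → α)) :
    IsFalling s ∨ IsSteady s ∨ IsRising s :=
  lt_trichotomy _ _

theorem IsFalling.not_isRising {s : Lex (ℕ → α)} (h : IsFalling s) : ¬ IsRising s :=
  lt_asymm (a := s) h

theorem IsSteady.not_isFalling {s : Lex (ℕ → α)} (h : IsSteady s) : ¬ IsFalling s :=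
  fun h' => (ne_of_lt (a := s) h') h

theorem IsSteady.not_isRising {s : Lex (ℕ → α)} (h : IsSteady s) : ¬ IsRising s :=
  fun h' => (ne_of_gt (a := s) h') h

theorem lex_head_mono {s t : Lex (ℕ → α)} (h : s ≤ t) : ofLex s 0 ≤ ofLex t 0 := by
  by_contra! hlt
  exact absurd h (not_le.2 ⟨0, by simp, hlt⟩)

theorem IsFalling.of_le {s t : Lex (ℕ → α)} (ht : IsFalling t) (h : s ≤ t)
    (h0 : ofLex s 0 = ofLex t 0) : IsFalling s := by
  rw [IsFalling, h0]
  exact h.trans_lt ht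

theorem IsRising.of_le {s t : Lex (ℕ → α)} (hs : IsRising s) (h : s ≤ t)
    (h0 : ofLex s 0 = ofLex t 0) : IsRising t := by
  rw [IsRising, ← h0]
  exact lt_of_lt_of_le hs h

/-- Prepending its own first letter `a` to a sequence below `a^∞` moves it up, but not past
`a^∞`. -/
theorem IsFalling.of_shift {s z : Lex (ℕ → α)} (hs : IsFalling s)
    (h0 : ofLex z 0 = ofLex s 0) (hz : ∀ j, ofLex z (j + 1) = ofLex s j) :
    s < z ∧ IsFalling z := by
  obtain ⟨i, hi, hlt⟩ := hs
  change ∀ j < i, ofLex s j = ofLex s 0 at hi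
  change ofLex s i < ofLex s 0 at hlt
  have hzi : ∀ j ≤ i, ofLex z j = ofLex s 0 := by
    rintro (_ | j) hj
    · exact h0
    · rw [hz, hi j (by omega)]
  refine ⟨⟨i, fun j hj => (hi j hj).trans (hzi j hj.le).symm, hlt.trans_eq (hzi i le_rfl).symm⟩,
    i + 1, fun j hj => (hzi j (by omega)).trans h0.symm, ?_⟩
  change ofLex z (i + 1) < ofLex z 0
  rwa [hz, h0]

/-- Prepending its own first letter `a` to a sequence above `a^∞` moves it down, but not past
`a^∞`. -/
theorem IsRising.of_shift {s z : Lex (ℕ → α)} (hs : IsRising s)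
    (h0 : ofLex z 0 = ofLex s 0) (hz : ∀ j, ofLex z (j + 1) = ofLex s j) :
    z < s ∧ IsRising z := by
  obtain ⟨i, hi, hlt⟩ := hs
  change ∀ j < i, ofLex s 0 = ofLex s j at hi
  change ofLex s 0 < ofLex s i at hlt
  have hzi : ∀ j ≤ i, ofLex z j = ofLex s 0 := by
    rintro (_ | j) hj
    · exact h0
    · rw [hz, hi j (by omega)]
  refine ⟨⟨i, fun j hj => (hzi j hj.le).trans (hi j hj), (hzi i le_rfl).trans_lt hlt⟩,
    i + 1, fun j hj => h0.trans (hzi j (by omega)).symm, ?_⟩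
  change ofLex z 0 < ofLex z (i + 1)
  rwa [hz, h0]

end LexSequences

section SortedSequences

variable [LinearOrder α] {β : Type*} (s : β → Lex (ℕ → α)) (p : β → α)

open Classical in
/-- The letters `a` such that `a^∞` occurs in `l`. -/
noncomputable def steadyLetters (l : List β) : Finset α :=
  ((l.filter (fun x => IsSteady (s x))).map (fun x => ofLex (s x) 0)).toFinset

theorem mem_steadyLetters {l : List β} {a : α} :
    a ∈ steadyLetters s l ↔ ∃ x ∈ l, IsSteady (s x) ∧ ofLex (s x) 0 = a := by
  simp [steadyLetters, and_assoc]

theorem steadyLetters_subset {l l' : List β} (h : l ⊆ l') :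
    steadyLetters s l ⊆ steadyLetters s l' := by
  intro a ha
  obtain ⟨x, hx, hx'⟩ := (mem_steadyLetters s).1 ha
  exact (mem_steadyLetters s).2 ⟨x, h hx, hx'⟩

/-- The number of elements whose preceding letter differs from their first letter. -/
def runStarts (l : List β) : ℕ := l.countP (fun x => p x ≠ ofLex (s x) 0)

theorem runStarts_cons (x : β) (l : List β) :
    runStarts s p (x :: l) = runStarts s p l + if p x = ofLex (s x) 0 then 0 else 1 := by
  by_cases h : p x = ofLex (s x) 0 <;> simp [runStarts, h, -Pi.ofLex_apply]

open Classical in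
theorem runsCount_suffix_le {l : List β} (hsort : l.Pairwise (fun x y => s x ≤ s y))
    (hsteady : ∀ x ∈ l, IsSteady (s x) → p x = ofLex (s x) 0)
    (hpred : ∀ x ∈ l, p x = ofLex (s x) 0 →
      ∃ z ∈ l, ofLex (s z) 0 = ofLex (s x) 0 ∧ ∀ j, ofLex (s z) (j + 1) = ofLex (s x) j)
    (t : List β) : ∀ (pre : List β) (x : β), l = pre ++ x :: t →
      runsCount ((x :: t).map p)
        + (if IsFalling (s x) ∧ p x ≠ ofLex (s x) 0 then 1 else 0) ≤
      2 * runStarts s p (x :: t) + (steadyLetters s (x :: t)).card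
        + (if IsRising (s x) ∧ p x = ofLex (s x) 0 then 1 else 0) := by
  have hle : ∀ (pre : List β) (x : β) (t : List β), l = pre ++ x :: t →
      (∀ z ∈ pre, s z ≤ s x) ∧ ∀ z ∈ t, s x ≤ s z := by
    intro pre x t hl
    rw [hl, List.pairwise_append, List.pairwise_cons] at hsort
    exact ⟨fun z hz => hsort.2.2 z hz x (by simp), hsort.2.1.1⟩
  have hup : ∀ (pre : List β) (x : β) (t : List β), l = pre ++ x :: t →
      IsFalling (s x) → p x = ofLex (s x) 0 →
      ∃ z ∈ t, ofLex (s z) 0 = ofLex (s x) 0 ∧ IsFalling (s z) := by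
    intro pre x t hl hx hp
    obtain ⟨z, hz, hz0, hzs⟩ := hpred x (by simp [hl]) hp
    obtain ⟨h1, h2⟩ := hx.of_shift hz0 hzs
    refine ⟨z, ?_, hz0, h2⟩
    rw [hl, List.mem_append, List.mem_cons] at hz
    rcases hz with hz | rfl | hz
    · exact absurd ((hle pre x t hl).1 z hz) (not_le.2 h1)
    · exact absurd h1 (lt_irrefl _)
    · exact hz
  have hdown : ∀ (pre : List β) (x : β) (t : List β), l = pre ++ x :: t →
      IsRising (s x) → p x = ofLex (s x) 0 →
      ∃ z ∈ pre, ofLex (s z) 0 = ofLex (s x) 0 ∧ IsRising (s z) := by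
    intro pre x t hl hx hp
    obtain ⟨z, hz, hz0, hzs⟩ := hpred x (by simp [hl]) hp
    obtain ⟨h1, h2⟩ := hx.of_shift hz0 hzs
    refine ⟨z, ?_, hz0, h2⟩
    rw [hl, List.mem_append, List.mem_cons] at hz
    rcases hz with hz | rfl | hz
    · exact hz
    · exact absurd h1 (lt_irrefl _)
    · exact absurd ((hle pre x t hl).2 z hz) (not_le.2 h1)
  induction t with
  | nil =>
    intro pre x hl
    rw [runStarts_cons]
    rcases isFalling_or_isSteady_or_isRising (s x) with h | h | h
    · have : p x ≠ ofLex (s x) 0 := fun h' => by simpa using hup pre x [] hl h h'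
      simp [runsCount, runStarts, h, this, -Pi.ofLex_apply]
    · have : 0 < (steadyLetters s [x]).card :=
        Finset.card_pos.2 ⟨_, (mem_steadyLetters s).2 ⟨x, by simp, h, rfl⟩⟩
      simp [runsCount, hsteady x (by simp [hl]) h]
      omega
    · have : ¬ IsFalling (s x) := fun h' => h'.not_isRising h
      by_cases hp : p x = ofLex (s x) 0 <;>
        simp [runsCount, runStarts, h, this, hp, -Pi.ofLex_apply]
      omega
  | cons y t ih =>
    intro pre x hl
    have hl' : l = (pre ++ [x]) ++ y :: t := by simp [hl]
    have IH := ih (pre ++ [x]) y hl'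
    have hpre := (hle pre x (y :: t) hl).1
    have ht := (hle _ y t hl').2
    have hxy : s x ≤ s y := (hle pre x (y :: t) hl).2 y (by simp)
    have hxy0 := lex_head_mono hxy
    have hcard := Finset.card_le_card
      (steadyLetters_subset s (List.subset_cons_self x (y :: t)))
    -- a rising element preceded by its own letter continues the group of the previous element
    have hy : IsRising (s y) → p y = ofLex (s y) 0 →
        ofLex (s x) 0 = ofLex (s y) 0 ∧ IsRising (s x) := by
      intro h1 h2
      obtain ⟨z, hz, hz0, hzc⟩ := hdown _ y t hl' h1 h2
      have hzx : s z ≤ s x := by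
        rw [List.mem_append, List.mem_singleton] at hz
        rcases hz with hz | rfl
        · exact hpre z hz
        · exact le_rfl
      have h0 := le_antisymm hxy0 (hz0 ▸ lex_head_mono hzx)
      exact ⟨h0, hzc.of_le hzx (hz0.trans h0.symm)⟩
    -- a falling element preceded by its own letter is followed by an element of the same group
    have hx : IsFalling (s x) → p x = ofLex (s x) 0 →
        ofLex (s y) 0 = ofLex (s x) 0 ∧ IsFalling (s y) := by
      intro h1 h2
      obtain ⟨z, hz, hz0, hzc⟩ := hup pre x (y :: t) hl h1 h2
      have hyz : s y ≤ s z := by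
        rcases List.mem_cons.1 hz with rfl | hz
        · exact le_rfl
        · exact ht z hz
      have h0 := le_antisymm (hz0 ▸ lex_head_mono hyz) hxy0
      exact ⟨h0, hzc.of_le hyz (h0.trans hz0.symm)⟩
    rw [List.map_cons] at IH
    rw [List.map_cons, List.map_cons, runsCount_cons_cons, runStarts_cons]
    rcases isFalling_or_isSteady_or_isRising (s x) with h | h | h
    · have hr := h.not_isRising
      by_cases hp : p x = ofLex (s x) 0
      · obtain ⟨h0, hlt⟩ := hx h hp
        have hr' := hlt.not_isRising
        by_cases hq : p y = ofLex (s y) 0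
        · have hpq : p x = p y := by rw [hp, hq, h0]
          simp only [hpq, hq, hlt, hr', h, hr, h0, ne_eq, not_true_eq_false, and_false,
            false_and, if_true, if_false] at IH ⊢
          omega
        · simp only [hp, hq, hlt, hr', h, hr, ne_eq, not_true_eq_false, not_false_eq_true,
            and_false, and_true, if_true, if_false] at IH ⊢
          split_ifs <;> omega
      · have hy' : ¬ (IsRising (s y) ∧ p y = ofLex (s y) 0) := fun h' => hr (hy h'.1 h'.2).2
        simp only [hy', hp, h, hr, ne_eq, not_false_eq_true, and_true, if_true,
          if_false] at IH ⊢
        split_ifs at IH ⊢ <;> omega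
    · have hp := hsteady x (by simp [hl]) h
      have hr := h.not_isRising
      have hf := h.not_isFalling
      have hy' : ¬ (IsRising (s y) ∧ p y = ofLex (s y) 0) := fun h' => hr (hy h'.1 h'.2).2
      simp only [hy', hf, hr, hp, false_and, if_true, if_false] at IH ⊢
      by_cases hq : ofLex (s x) 0 = p y
      · simp only [hq, if_true]
        split_ifs at IH <;> omega
      · have hnot : ofLex (s x) 0 ∉ steadyLetters s (y :: t) := by
          intro hmem
          obtain ⟨z, hz, hzc, hz0⟩ := (mem_steadyLetters s).1 hmem
          have hyz : s y ≤ s z := by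
            rcases List.mem_cons.1 hz with rfl | hz
            · exact le_rfl
            · exact ht z hz
          rw [IsSteady, hz0, ← h] at hzc
          have hyx : s y = s x := le_antisymm (hzc ▸ hyz) hxy
          apply hq
          rw [hsteady y (by simp [hl]) (by rw [hyx]; exact h), hyx]
        have : (steadyLetters s (y :: t)).card < (steadyLetters s (x :: y :: t)).card :=
          Finset.card_lt_card ((Finset.ssubset_iff_of_subset
            (steadyLetters_subset s (List.subset_cons_self x (y :: t)))).2
              ⟨_, (mem_steadyLetters s).2 ⟨x, by simp, h, rfl⟩, hnot⟩)
        simp only [hq, if_false]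
        split_ifs at IH <;> omega
    · have hf : ¬ IsFalling (s x) := fun h' => h'.not_isRising h
      by_cases hp : p x = ofLex (s x) 0
      · by_cases hy' : IsRising (s y) ∧ p y = ofLex (s y) 0
        · have hpq : p x = p y := by rw [hp, (hy hy'.1 hy'.2).1, hy'.2]
          simp only [if_pos hy', if_pos hpq, if_pos hp, hf, false_and, if_false,
            if_pos (And.intro h hp)] at IH ⊢
          split_ifs at IH <;> omega
        · simp only [if_neg hy', if_pos hp, hf, false_and, if_false,
            if_pos (And.intro h hp)] at IH ⊢
          split_ifs at IH ⊢ <;> omega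
      · simp only [hf, hp, false_and, and_false, if_false]
        split_ifs at IH ⊢ <;> omega

/-- In a sorted list of infinite sequences `s x`, each with a preceding letter `p x`, such that
sequences preceded by their own first letter `a` have a left extension by `a` in the list,
the preceding letters form few runs. -/
theorem runsCount_map_le {l : List β} (hsort : l.Pairwise (fun x y => s x ≤ s y))
    (hsteady : ∀ x ∈ l, IsSteady (s x) → p x = ofLex (s x) 0)
    (hpred : ∀ x ∈ l, p x = ofLex (s x) 0 →
      ∃ z ∈ l, ofLex (s z) 0 = ofLex (s x) 0 ∧ ∀ j, ofLex (s z) (j + 1) = ofLex (s x) j) :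
    runsCount (l.map p) ≤ 2 * runStarts s p l + (steadyLetters s l).card := by
  classical
  cases l with
  | nil => simp [runsCount]
  | cons x t =>
    have h := runsCount_suffix_le s p hsort hsteady hpred t [] x rfl
    have hx : ¬ (IsRising (s x) ∧ p x = ofLex (s x) 0) := by
      rintro ⟨h1, h2⟩
      obtain ⟨z, hz, hz0, hzs⟩ := hpred x (by simp) h2
      have h3 := (h1.of_shift hz0 hzs).1
      rcases List.mem_cons.1 hz with rfl | hz
      · exact lt_irrefl _ h3
      · exact absurd ((List.pairwise_cons.1 hsort).1 z hz) (not_le.2 h3)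
    rw [if_neg hx] at h
    omega

end SortedSequences

theorem iterate_rot (x : List α) (i : ℕ) : rot^[i] x = x.rotate i := by
  have h : ∀ y : List α, rot y = y.rotate 1 := by
    rintro (_ | ⟨a, t⟩) <;> simp [rot]
  induction i generalizing x with
  | zero => simp
  | succ i ih => rw [Function.iterate_succ_apply, ih, h, List.rotate_rotate, add_comm]

section Lyndon

variable [LinearOrder α]

/-- A comparison with a shorter list is decided at a position inside both lists. -/
theorem append_lt_append_of_lt {u v : List α} (h : u < v) (hlen : v.length ≤ u.length)
    (x y : List α) : u ++ x < v ++ y := by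
  rw [List.lt_iff_exists] at h ⊢
  rcases h with ⟨-, h⟩ | ⟨i, h1, h2, h3, h4⟩
  · omega
  · refine .inr ⟨i, by simp; omega, by simp; omega, fun j hj => ?_, ?_⟩
    · rw [List.getElem_append_left (by omega), List.getElem_append_left (by omega), h3 j hj]
    · rwa [List.getElem_append_left h1, List.getElem_append_left h2]

theorem append_lt_append_left {u x y : List α} (h : x < y) : u ++ x < u ++ y :=
  List.append_left_lt h

theorem lt_of_append_lt_append_of_length_eq {u v x y : List α} (hlen : u.length = v.length)
    (h : u ++ x < v ++ y) : u ≤ v := by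
  by_contra! hlt
  exact lt_asymm h (append_lt_append_of_lt hlt hlen.le y x)

theorem isLyndon_iff_lt_suffix (x : List α) :
    IsLyndon x ↔ x ≠ [] ∧ ∀ u v, x = u ++ v → u ≠ [] → v ≠ [] → x < v := by
  constructor
  · rintro ⟨hx, h⟩
    refine ⟨hx, ?_⟩
    rintro u v rfl hu hv
    have hu' := List.length_pos_iff.2 hu
    have hv' := List.length_pos_iff.2 hv
    have h1 := h u.length (by simp; omega) hu'
    rw [iterate_rot, List.rotate_append_length_eq] at h1
    by_contra! hle
    have hne : v ≠ u ++ v := fun h' => by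
      have := congrArg List.length h'
      simp at this
      exact hu this
    have hlt : v < u ++ v := lt_of_le_of_ne hle hne
    rw [List.lt_iff_exists] at hlt
    rcases hlt with ⟨hpre, hlen⟩ | ⟨i, h2, h3, h4, h5⟩
    · -- `v` is a border of `u ++ v`
      obtain ⟨z, hz⟩ : ∃ z, u ++ v = v ++ z :=
        ⟨(u ++ v).drop v.length, by
          conv_lhs => rw [← List.take_append_drop v.length (u ++ v), ← hpre]⟩
      have hzl : z.length = u.length := by
        have := congrArg List.length hz
        simp at this
        omega
      have hzu : z < u := by
        rw [hz] at h1
        rcases lt_trichotomy z u with h' | h' | h'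
        · exact h'
        · exact absurd (h' ▸ h1) (lt_irrefl _)
        · exact absurd h1 (append_lt_append_left h').not_gt
      have h6 := h v.length (by simp; omega) hv'
      rw [iterate_rot, hz, List.rotate_append_length_eq, ← hz] at h6
      exact absurd (lt_of_append_lt_append_of_length_eq hzl.symm h6) (not_le.2 hzu)
    · refine lt_asymm h1 (List.lt_iff_exists.2 (.inr ⟨i, by simp; omega, h3, fun j hj => ?_, ?_⟩))
      · rw [List.getElem_append_left (by omega)]
        exact h4 j hj
      · rw [List.getElem_append_left h2]
        exact h5
  · rintro ⟨hx, h⟩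
    refine ⟨hx, fun i hi hi0 => ?_⟩
    rw [iterate_rot, List.rotate_eq_drop_append_take hi.le]
    have h1 := h (x.take i) (x.drop i) (List.take_append_drop i x).symm
      (by simp [hx]; omega) (by simpa using hi)
    simpa using append_lt_append_of_lt h1 (by simp) [] (x.take i)

theorem IsLyndon.append {u v : List α} (hu : IsLyndon u) (hv : IsLyndon v) (huv : u < v) :
    IsLyndon (u ++ v) := by
  rw [isLyndon_iff_lt_suffix] at hu hv ⊢
  have hlt : u ++ v < v := by
    have huv' := huv
    rw [List.lt_iff_exists] at huv
    rcases huv with ⟨hpre, hlen⟩ | ⟨i, h1, h2, h3, h4⟩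
    · obtain ⟨z, rfl⟩ : ∃ z, v = u ++ z :=
        ⟨v.drop u.length, by conv_lhs => rw [← List.take_append_drop u.length v, ← hpre]⟩
      refine append_lt_append_left (hv.2 u z rfl hu.1 ?_)
      rintro rfl
      simp at hlen
    · refine List.lt_iff_exists.2 (.inr ⟨i, by simp; omega, h2, fun j hj => ?_, ?_⟩)
      · rw [List.getElem_append_left (by omega)]
        exact h3 j hj
      · rw [List.getElem_append_left h1]
        exact h4
  refine ⟨by simp [hu.1], fun x y hxy hx hy => ?_⟩
  rcases List.append_eq_append_iff.1 hxy with ⟨c, rfl, hc⟩ | ⟨c, hc, rfl⟩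
  · rcases eq_or_ne c [] with rfl | hc0
    · simp only [List.nil_append] at hc
      exact hc ▸ hlt
    · exact hlt.trans (hv.2 c y hc hc0 hy)
  · rcases eq_or_ne c [] with rfl | hc0
    · simpa using hlt
    · exact append_lt_append_of_lt (hu.2 x c hc hx hc0) (by simp [hc]) v v

theorem isLyndon_singleton (a : α) : IsLyndon [a] :=
  ⟨by simp, fun i hi hi0 => by simp at hi; omega⟩

theorem firstLyndonFactor_spec {w : List α} (hw : w ≠ []) :
    IsLyndon (firstLyndonFactor w) ∧ firstLyndonFactor w <+: w ∧
      ∀ x, IsLyndon x → x <+: w → x.length ≤ (firstLyndonFactor w).length := by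
  set l := ((List.range (w.length + 1)).map (fun i => w.take i)).filter
    (fun x => decide (IsLyndon x)) with hl
  have hmem : ∀ x, x ∈ l ↔ IsLyndon x ∧ x <+: w := by
    intro x
    simp only [hl, List.mem_filter, List.mem_map, List.mem_range, decide_eq_true_eq]
    constructor
    · rintro ⟨⟨i, -, rfl⟩, h⟩
      exact ⟨h, List.take_prefix i w⟩
    · rintro ⟨h, hp⟩
      exact ⟨⟨x.length, by have := hp.length_le; omega, (List.prefix_iff_eq_take.1 hp).symm⟩, h⟩
  have hpw : l.Pairwise (fun x y => x.length ≤ y.length) := by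
    refine List.Pairwise.filter _ (List.pairwise_map.2 ?_)
    refine List.pairwise_lt_range.imp fun h => ?_
    simp only [List.length_take]
    omega
  have hne : l ≠ [] := by
    obtain ⟨a, t, rfl⟩ := List.exists_cons_of_ne_nil hw
    exact List.ne_nil_of_mem ((hmem [a]).2 ⟨isLyndon_singleton a, by simp⟩)
  have hf : firstLyndonFactor w = l.getLast hne := by
    rw [firstLyndonFactor, ← hl, List.getLastD_eq_getLast?, List.getLast?_eq_some_getLast hne,
      Option.getD_some]
  rw [hf]
  obtain ⟨h1, h2⟩ := (hmem _).1 (List.getLast_mem hne)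
  refine ⟨h1, h2, fun x hx hxw => ?_⟩
  have hx := (hmem x).2 ⟨hx, hxw⟩
  rw [← List.dropLast_append_getLast hne, List.pairwise_append] at hpw
  rw [← List.dropLast_append_getLast hne, List.mem_append, List.mem_singleton] at hx
  rcases hx with hx | hx
  · exact hpw.2.2 x hx _ (by simp)
  · rw [← hx]

theorem lyndonFactAux_cons (n : ℕ) {w : List α} (hw : w ≠ []) :
    lyndonFactAux (n + 1) w =
      firstLyndonFactor w :: lyndonFactAux n (w.drop (firstLyndonFactor w).length) := by
  obtain ⟨a, t, rfl⟩ := List.exists_cons_of_ne_nil hw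
  have := (firstLyndonFactor_spec hw).1.1
  simp [lyndonFactAux, this]

theorem lyndonFactAux_spec (n : ℕ) (w : List α) (hn : w.length ≤ n) :
    (lyndonFactAux n w).flatten = w ∧ (∀ x ∈ lyndonFactAux n w, IsLyndon x) ∧
      (lyndonFactAux n w).IsChain (fun x y => y ≤ x) := by
  induction n generalizing w with
  | zero =>
    obtain rfl : w = [] := by simpa using hn
    simp [lyndonFactAux]
  | succ n ih =>
    rcases eq_or_ne w [] with rfl | hw
    · simp [lyndonFactAux]
    obtain ⟨h1, ⟨w', h2⟩, h3⟩ := firstLyndonFactor_spec hw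
    rw [lyndonFactAux_cons n hw]
    set p := firstLyndonFactor w
    have hp := List.length_pos_iff.2 h1.1
    have hd : w.drop p.length = w' := by rw [← h2, List.drop_left]
    rw [hd]
    have hlen : w'.length ≤ n := by
      have := congrArg List.length h2
      simp at this
      omega
    obtain ⟨i1, i2, i3⟩ := ih w' hlen
    refine ⟨by simp [i1, h2], by simpa using ⟨h1, i2⟩, ?_⟩
    rw [List.isChain_cons]
    refine ⟨fun q hq => ?_, i3⟩
    by_contra! hlt
    have hq' : q ∈ lyndonFactAux n w' := List.mem_of_mem_head? hq
    have hqL := i2 q hq'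
    have hpre : q <+: w' := by
      cases hc : lyndonFactAux n w' with
      | nil => simp [hc] at hq
      | cons q' r =>
        rw [hc] at hq i1
        simp only [List.head?_cons, Option.mem_def, Option.some.injEq] at hq
        exact ⟨r.flatten, by rw [← i1, ← hq]; simp⟩
    have := h3 (p ++ q) (h1.append hqL hlt)
      (by rw [← h2]; exact (List.prefix_append_right_inj p).2 hpre)
    have hq0 := List.length_pos_iff.2 hqL.1
    rw [List.length_append] at this
    omega

theorem IsLyndon.head_lt_getLast {a b : α} {t : List α} (h : IsLyndon (a :: t ++ [b])) :
    a < b := by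
  have h1 := ((isLyndon_iff_lt_suffix _).1 h).2 (a :: t) [b] rfl (by simp) (by simp)
  rw [List.cons_append, List.cons_lt_cons_iff] at h1
  simpa using h1

end Lyndon

theorem length_listPow (x : List α) (n : ℕ) : (listPow x n).length = n * x.length := by
  induction n with
  | zero => simp [listPow]
  | succ n ih => rw [listPow, List.length_append, ih]; ring

theorem rotations_eq (x : List α) : rotations x = (List.range x.length).map x.rotate :=
  List.map_congr_left fun i _ => iterate_rot x i

theorem mem_rotations {x r : List α} (hx : x ≠ []) :
    r ∈ rotations x ↔ ∃ i, r = x.rotate i := by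
  simp only [rotations_eq, List.mem_map, List.mem_range]
  constructor
  · rintro ⟨i, -, rfl⟩
    exact ⟨i, rfl⟩
  · rintro ⟨i, rfl⟩
    exact ⟨i % x.length, Nat.mod_lt _ (List.length_pos_iff.2 hx), List.rotate_mod x i⟩

section OmegaWord

variable (d : α)

/-- The infinite periodic word `x^∞`; the letter `d` is only used for empty `x`. -/
def omegaWord (x : List α) : Lex (ℕ → α) := toLex (fun j => x.getD (j % x.length) d)

theorem omegaWord_apply (x : List α) (j : ℕ) :
    ofLex (omegaWord d x) j = x.getD (j % x.length) d := rfl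

theorem omegaWord_rotate (x : List α) (i j : ℕ) :
    ofLex (omegaWord d (x.rotate i)) j = ofLex (omegaWord d x) (i + j) := by
  rcases eq_or_ne x [] with rfl | hx
  · rfl
  have hlen := List.length_pos_iff.2 hx
  rw [omegaWord_apply, omegaWord_apply, List.length_rotate, List.getD_eq_getElem?_getD,
    List.getElem?_rotate (Nat.mod_lt _ hlen), List.getD_eq_getElem?_getD, Nat.mod_add_mod,
    add_comm j i]

theorem omegaWord_add_mul_length (x : List α) (j k : ℕ) :
    ofLex (omegaWord d x) (j + x.length * k) = ofLex (omegaWord d x) j := by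
  simp only [omegaWord_apply, Nat.add_mul_mod_self_left]

theorem getElem_listPow (x : List α) (n j : ℕ) (hj : j < (listPow x n).length) :
    (listPow x n)[j] = ofLex (omegaWord d x) j := by
  induction n generalizing j with
  | zero => simp [listPow] at hj
  | succ n ih =>
    simp only [listPow] at hj ⊢
    rw [List.getElem_append]
    split_ifs with h
    · rw [omegaWord_apply, Nat.mod_eq_of_lt h, List.getD_eq_getElem _ _ h]
    · rw [ih, ← omegaWord_add_mul_length d x _ 1, mul_one, Nat.sub_add_cancel (not_lt.1 h)]

/-- The last letter of `x`, read off from `x^∞`. -/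
def omegaLast (x : List α) : α := ofLex (omegaWord d x) (x.length - 1)

theorem getLast?_eq_omegaLast {x : List α} (hx : x ≠ []) :
    x.getLast? = some (omegaLast d x) := by
  have hlen := List.length_pos_iff.2 hx
  rw [List.getLast?_eq_getElem?, omegaLast, omegaWord_apply, Nat.mod_eq_of_lt (by omega),
    List.getD_eq_getElem _ _ (by omega), List.getElem?_eq_getElem (by omega)]

theorem IsSteady.of_rotate {x : List α} {i : ℕ} (hx : x ≠ [])
    (h : IsSteady (omegaWord d (x.rotate i))) :
    IsSteady (omegaWord d x) ∧
      ofLex (omegaWord d (x.rotate i)) 0 = ofLex (omegaWord d x) 0 := by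
  have hlen := List.length_pos_iff.2 hx
  have hj : ∀ j, ofLex (omegaWord d x) j = ofLex (omegaWord d (x.rotate i)) 0 := by
    intro j
    have h1 : ofLex (omegaWord d (x.rotate i)) (j + x.length * i - i) = _ :=
      congrFun (congrArg ofLex h) _
    have hi : i ≤ x.length * i := Nat.le_mul_of_pos_left i hlen
    rw [omegaWord_rotate, show i + (j + x.length * i - i) = j + x.length * i by omega,
      omegaWord_add_mul_length] at h1
    exact h1
  exact ⟨ofLex.injective (funext fun j => (hj j).trans (hj 0).symm), (hj 0).symm⟩

variable [LinearOrder α]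

theorem omegaWord_lt_of_listPow_lt {x y : List α}
    (h : listPow x y.length < listPow y x.length) : omegaWord d x < omegaWord d y := by
  rw [List.lt_iff_exists] at h
  rcases h with ⟨-, h⟩ | ⟨i, h1, h2, h3, h4⟩
  · simp only [length_listPow, mul_comm y.length] at h
    exact absurd h (lt_irrefl _)
  · simp only [getElem_listPow d] at h3 h4
    exact ⟨i, h3, h4⟩

theorem omegaLE_iff {x y : List α} (hx : x ≠ []) (hy : y ≠ []) :
    omegaLE x y ↔ omegaWord d x ≤ omegaWord d y := by
  constructor
  · intro h
    rcases (show listPow x y.length ≤ listPow y x.length from h).lt_or_eq with h | h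
    · exact (omegaWord_lt_of_listPow_lt d h).le
    · refine le_of_eq (ofLex.injective (funext fun j => ?_))
      have hN : 0 < x.length * y.length :=
        Nat.mul_pos (List.length_pos_iff.2 hx) (List.length_pos_iff.2 hy)
      have key : ∀ k < x.length * y.length,
          ofLex (omegaWord d x) k = ofLex (omegaWord d y) k := by
        intro k hk
        rw [← getElem_listPow d x y.length k (by rwa [length_listPow, mul_comm]),
          ← getElem_listPow d y x.length k (by rwa [length_listPow])]
        simp only [h]
      have h1 := omegaWord_add_mul_length d x (j % (x.length * y.length))
        (y.length * (j / (x.length * y.length)))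
      have h2 := omegaWord_add_mul_length d y (j % (x.length * y.length))
        (x.length * (j / (x.length * y.length)))
      rw [← mul_assoc, Nat.mod_add_div] at h1
      rw [← mul_assoc, mul_comm y.length, Nat.mod_add_div] at h2
      rw [h1, h2, key _ (Nat.mod_lt _ hN)]
  · intro h
    by_contra hlt
    exact absurd h (not_le.2 (omegaWord_lt_of_listPow_lt d (not_le.1 hlt)))

theorem IsLyndon.eq_singleton_of_isSteady {x : List α} (hx : IsLyndon x)
    (h : IsSteady (omegaWord d x)) : ∃ a, x = [a] := by
  obtain ⟨a, t, rfl⟩ := List.exists_cons_of_ne_nil hx.1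
  rcases List.eq_nil_or_concat t with rfl | ⟨t, b, rfl⟩
  · exact ⟨a, rfl⟩
  · rw [List.concat_eq_append, ← List.cons_append] at hx h
    have h1 : ofLex (omegaWord d (a :: t ++ [b])) (t.length + 1) =
      ofLex (omegaWord d (a :: t ++ [b])) 0 := congrFun (congrArg ofLex h) _
    rw [omegaWord_apply, omegaWord_apply, Nat.mod_eq_of_lt (by simp)] at h1
    simp at h1
    exact absurd h1 hx.head_lt_getLast.ne'

theorem runsCount_cons_eq (a : α) (t : List α) :
    runsCount (a :: t) =
      (List.range t.length).countP
        (fun i => (a :: t).getD i d ≠ (a :: t).getD (i + 1) d) + 1 := by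
  induction t generalizing a with
  | nil => simp [runsCount]
  | cons b t ih =>
    rw [runsCount_cons_cons, ih, List.length_cons, List.range_succ_eq_map, List.countP_cons,
      List.countP_map]
    by_cases h : a = b <;> simp [h, Function.comp_def]
    omega

theorem runStarts_rotations_le {x : List α} (hx : x ≠ []) :
    runStarts (omegaWord d) (omegaLast d) (rotations x) ≤ runsCount x := by
  obtain ⟨a, t, rfl⟩ := List.exists_cons_of_ne_nil hx
  rw [runsCount_cons_eq d, rotations_eq, runStarts, List.countP_map, List.length_cons,
    List.range_succ_eq_map, List.countP_cons, List.countP_map]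
  refine add_le_add (List.countP_mono_left fun i hi => ?_) (by split_ifs <;> simp)
  rw [List.mem_range] at hi
  simp only [Function.comp_apply, decide_eq_true_eq, omegaLast, omegaWord_rotate]
  rw [List.length_rotate, List.length_cons,
    show i.succ + (t.length + 1 - 1) = i + (a :: t).length * 1 by simp; omega,
    omegaWord_add_mul_length, omegaWord_apply, omegaWord_apply, List.length_cons,
    Nat.mod_eq_of_lt (by omega), Nat.mod_eq_of_lt (by omega)]
  exact id

theorem runsCount_append_cons {u v : List α} {a b : α} (hab : a ≠ b) :
    runsCount (u ++ [a] ++ b :: v) = runsCount (u ++ [a]) + runsCount (b :: v) := by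
  induction u with
  | nil => simp [runsCount, hab]
  | cons c u ih =>
    cases u with
    | nil =>
      simp only [List.nil_append, List.cons_append, runsCount_cons_cons] at ih ⊢
      omega
    | cons e u =>
      simp only [List.cons_append, runsCount_cons_cons] at ih ⊢
      omega

theorem runStarts_append {β : Type*} (s : β → Lex (ℕ → α)) (p : β → α) (l l' : List β) :
    runStarts s p (l ++ l') = runStarts s p l + runStarts s p l' :=
  List.countP_append

theorem steadyLetters_cons_of_not {β : Type*} (s : β → Lex (ℕ → α)) {x : β} (l : List β)
    (hx : ¬ IsSteady (s x)) : steadyLetters s (x :: l) = steadyLetters s l := by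
  simp [steadyLetters, hx]

theorem steadyLetters_cons {β : Type*} (s : β → Lex (ℕ → α)) {x : β} (l : List β)
    (hx : IsSteady (s x)) :
    steadyLetters s (x :: l) = insert (ofLex (s x) 0) (steadyLetters s l) := by
  ext a
  simp only [mem_steadyLetters, List.mem_cons, Finset.mem_insert]
  grind

theorem runStarts_add_card_steadyLetters_le (Ls : List (List α))
    (hL : ∀ x ∈ Ls, IsLyndon x) (hchain : Ls.IsChain (fun x y => y ≤ x)) :
    runStarts (omegaWord d) (omegaLast d) (Ls.map rotations).flatten
      + (steadyLetters (omegaWord d) Ls).card ≤ runsCount Ls.flatten := by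
  induction Ls with
  | nil => simp [runStarts, steadyLetters, runsCount]
  | cons x Ls ih =>
    have IH := ih (fun y hy => hL y (by simp [hy])) hchain.tail
    have hx := hL x (by simp)
    rw [List.map_cons, List.flatten_cons, List.flatten_cons, runStarts_append]
    by_cases hst : IsSteady (omegaWord d x)
    · obtain ⟨a, rfl⟩ := hx.eq_singleton_of_isSteady d hst
      have h0 : runStarts (omegaWord d) (omegaLast d) (rotations [a]) = 0 := by
        simp [rotations_eq, runStarts, omegaLast]
      rw [h0, steadyLetters_cons _ _ hst]
      have hcard := Finset.card_insert_le (ofLex (omegaWord d [a]) 0)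
        (steadyLetters (omegaWord d) Ls)
      cases Ls with
      | nil =>
        simp only [List.map_nil, List.flatten_nil, runStarts, List.countP_nil, List.append_nil,
          runsCount] at IH ⊢
        omega
      | cons y Ls =>
        have hy := hL y (by simp)
        obtain ⟨b, t, rfl⟩ := List.exists_cons_of_ne_nil hy.1
        have hba : b :: t ≤ [a] := (List.isChain_cons_cons.1 hchain).1
        simp only [List.flatten_cons, List.cons_append, List.nil_append] at IH ⊢
        rw [runsCount_cons_cons]
        by_cases hab : a = b
        · subst hab
          obtain rfl : t = [] := by
            rcases eq_or_ne t [] with h | h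
            · exact h
            · obtain ⟨c, t, rfl⟩ := List.exists_cons_of_ne_nil h
              exact absurd hba (not_le.2 (by simp))
          rw [Finset.insert_eq_of_mem
            ((mem_steadyLetters _).2 ⟨[a], by simp, hst, rfl⟩), if_pos rfl]
          omega
        · rw [if_neg hab]
          omega
    · rw [steadyLetters_cons_of_not _ _ hst]
      have h1 := runStarts_rotations_le d hx.1
      suffices hsum : runsCount (x ++ Ls.flatten) = runsCount x + runsCount Ls.flatten by omega
      cases Ls with
      | nil => simp [runsCount]
      | cons y Ls =>
        have hy := hL y (by simp)
        obtain ⟨b, t, rfl⟩ := List.exists_cons_of_ne_nil hy.1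
        obtain ⟨a, u, rfl⟩ := List.exists_cons_of_ne_nil hx.1
        have hyx : b :: t ≤ a :: u := (List.isChain_cons_cons.1 hchain).1
        have hba : b ≤ a := by
          by_contra! h
          exact absurd hyx (not_le.2 (by simp [List.cons_lt_cons_iff, h]))
        rcases List.eq_nil_or_concat u with rfl | ⟨u, c, rfl⟩
        · exact absurd (ofLex.injective (funext fun j => by
            simp [omegaWord, Nat.mod_one])) hst
        · rw [List.concat_eq_append, ← List.cons_append] at hx ⊢
          simp only [List.flatten_cons]
          exact runsCount_append_cons (hba.trans_lt hx.head_lt_getLast).ne'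

theorem steadyLetters_rotations_subset (Ls : List (List α)) (hL : ∀ x ∈ Ls, x ≠ []) :
    steadyLetters (omegaWord d) (Ls.map rotations).flatten ⊆
      steadyLetters (omegaWord d) Ls := by
  intro a ha
  obtain ⟨r, hr, hst, rfl⟩ := (mem_steadyLetters _).1 ha
  obtain ⟨l, hl, hr⟩ := List.mem_flatten.1 hr
  obtain ⟨x, hx, rfl⟩ := List.mem_map.1 hl
  obtain ⟨i, rfl⟩ := (mem_rotations (hL x hx)).1 hr
  obtain ⟨h1, h2⟩ := hst.of_rotate d (hL x hx)
  exact (mem_steadyLetters _).2 ⟨x, hx, h1, h2.symm⟩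

end OmegaWord

/-- for every nonempty string `w`, `ρ(BBWT(w)) ≤ 2·ρ(w)`. -/
theorem stmt12 [LinearOrder α] (w : List α) (hw : w ≠ []) :
    runsCount (BBWT w) ≤ 2 * runsCount w := by
  obtain ⟨d, -⟩ := List.exists_mem_of_ne_nil w hw
  obtain ⟨hflat, hL, hchain⟩ := lyndonFactAux_spec w.length w le_rfl
  set Ls := lyndonFactAux w.length w with hLs
  set R := (Ls.map rotations).flatten with hR
  have hmemR : ∀ r, r ∈ R ↔ ∃ x ∈ Ls, ∃ i, r = x.rotate i := by
    intro r
    simp only [hR, List.mem_flatten, List.mem_map, exists_exists_and_eq_and]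
    exact exists_congr fun x => and_congr_right fun hx => mem_rotations (hL x hx).1
  have hne : ∀ r ∈ R, r ≠ [] := by
    intro r hr
    obtain ⟨x, hx, i, rfl⟩ := (hmemR r).1 hr
    simpa using (hL x hx).1
  set S := R.insertionSort omegaLE with hS
  have hperm : S.Perm R := List.perm_insertionSort _ _
  have hBBWT : BBWT w = S.map (omegaLast d) := by
    change S.filterMap List.getLast? = _
    rw [← List.filterMap_eq_map]
    exact List.filterMap_congr fun r hr => getLast?_eq_omegaLast d (hne r (hperm.mem_iff.1 hr))
  have hsort : S.Pairwise (fun x y => omegaWord d x ≤ omegaWord d y) := by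
    have h := List.map_insertionSort omegaLE (· ≤ ·) (omegaWord d) R
      fun x hx y hy => omegaLE_iff d (hne x hx) (hne y hy)
    rw [← List.pairwise_map (R := (· ≤ ·)), h]
    exact List.pairwise_insertionSort _ _
  have hmain := runsCount_map_le (omegaWord d) (omegaLast d) hsort
    (fun x _ hst => congrFun (congrArg ofLex hst) _) (by
      intro r hr hp
      obtain ⟨x, hx, i, rfl⟩ := (hmemR r).1 (hperm.mem_iff.1 hr)
      have hlen := List.length_pos_iff.2 (hL x hx).1
      refine ⟨x.rotate (i + (x.length - 1)), hperm.mem_iff.2 ((hmemR _).2 ⟨x, hx, _, rfl⟩),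
        ?_, fun j => ?_⟩
      · rw [← hp, omegaLast, omegaWord_rotate, omegaWord_rotate, List.length_rotate, add_zero]
      · rw [omegaWord_rotate, omegaWord_rotate, ← omegaWord_add_mul_length d x (i + j) 1]
        rw [show i + (x.length - 1) + (j + 1) = i + j + x.length * 1 by omega])
  have hstarts : runStarts (omegaWord d) (omegaLast d) S =
      runStarts (omegaWord d) (omegaLast d) R := hperm.countP_eq _
  have hcard : (steadyLetters (omegaWord d) S).card ≤ (steadyLetters (omegaWord d) Ls).card :=
    Finset.card_le_card ((steadyLetters_subset _ hperm.subset).trans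
      (steadyLetters_rotations_subset d Ls fun x hx => (hL x hx).1))
  have hfactors := runStarts_add_card_steadyLetters_le d Ls hL hchain
  rw [hflat, ← hR] at hfactors
  rw [hBBWT]
  omega
end

section
/- There is a constant C > 0 such that for every string w of length n ≥ 2, δ(BWT(w)) ≤ C · δ(w) · (log₂ n)². -/
/-! Basic definitions: strings as `List α`, rotations, runs, BWT, Lyndon
factorization, ω-order, bijective BWT, and Fibonacci words. -/

variable {α : Type*}

/-- The number of distinct length-`k` substrings of `w`. -/
def numDistinctSubstr [DecidableEq α] (w : List α) (k : ℕ) : ℕ :=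
  (((List.range (w.length - k + 1)).map (fun i => (w.drop i).take k)).dedup).length

/-- The substring complexity measure `δ(w) = max_{1 ≤ k ≤ |w|} S_k(w)/k`. -/
def deltaQ [DecidableEq α] (w : List α) : ℚ :=
  ((List.range w.length).map
    (fun k => (numDistinctSubstr w (k+1) : ℚ) / (k+1))).foldr max 0

/-- The length-`m` window starting at position `z` of the cyclic word `T`. -/
def cyclicWindow {n : ℕ} (T : ZMod n → α) (z : ZMod n) (m : ℕ) : List α :=
  (List.range m).map fun s : ℕ => T (z + (s : ZMod n))

lemma cyclicWindow_eq_iff {n : ℕ} {T : ZMod n → α} {a b : ZMod n} {m : ℕ} :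
    cyclicWindow T a m = cyclicWindow T b m ↔
      ∀ s < m, T (a + (s : ZMod n)) = T (b + (s : ZMod n)) := by
  simp [cyclicWindow, List.map_inj_left]

/-- The number of cyclic positions whose window agrees with the one at `z` on the offsets
in `[k, l)`. -/
def agreeCount [DecidableEq α] {n : ℕ} [NeZero n] (T : ZMod n → α) (z : ZMod n) (l k : ℕ) : ℕ :=
  (Finset.univ.filter fun q : ZMod n =>
    ∀ u ∈ Finset.Ico k l, T (q + (u : ZMod n)) = T (z + (u : ZMod n))).card

lemma agreeCount_mono [DecidableEq α] {n : ℕ} [NeZero n] (T : ZMod n → α) (z : ZMod n)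
    (l k : ℕ) : agreeCount T z l k ≤ agreeCount T z l (k + 1) := by
  refine Finset.card_le_card fun q hq => ?_
  simp only [Finset.mem_filter, Finset.mem_univ, true_and, Finset.mem_Ico] at hq ⊢
  exact fun u hu => hq u ⟨by omega, hu.2⟩

lemma agreeCount_pos [DecidableEq α] {n : ℕ} [NeZero n] (T : ZMod n → α) (z : ZMod n)
    (l k : ℕ) : 0 < agreeCount T z l k :=
  Finset.card_pos.mpr ⟨z, by simp⟩

lemma agreeCount_le [DecidableEq α] {n : ℕ} [NeZero n] (T : ZMod n → α) (z : ZMod n)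
    (l k : ℕ) : agreeCount T z l k ≤ n :=
  (Finset.card_le_univ _).trans (ZMod.card n).le

lemma agreeCount_congr [DecidableEq α] {n : ℕ} [NeZero n] {T : ZMod n → α} {a b : ZMod n}
    {l k : ℕ}
    (h : ∀ u ∈ Finset.Ico k l, T (a + (u : ZMod n)) = T (b + (u : ZMod n))) :
    agreeCount T a l k = agreeCount T b l k := by
  unfold agreeCount
  congr 1
  refine Finset.filter_congr fun q _ => forall₂_congr fun u hu => ?_
  rw [h u hu]

/-- Among two distinct left extensions of a common window, one occurs at most half as often
as the window. -/
lemma two_mul_agreeCount_le_or [DecidableEq α] {n : ℕ} [NeZero n] {T : ZMod n → α}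
    {a b : ZMod n} {l k : ℕ} (hk : k < l) (hne : T (a + (k : ZMod n)) ≠ T (b + (k : ZMod n)))
    (h : ∀ u ∈ Finset.Ico (k + 1) l, T (a + (u : ZMod n)) = T (b + (u : ZMod n))) :
    2 * agreeCount T a l k ≤ agreeCount T a l (k + 1) ∨
      2 * agreeCount T b l k ≤ agreeCount T b l (k + 1) := by
  have hsum : agreeCount T a l k + agreeCount T b l k ≤ agreeCount T a l (k + 1) := by
    unfold agreeCount
    rw [← Finset.card_union_of_disjoint]
    · refine Finset.card_le_card fun q hq => ?_
      simp only [Finset.mem_union, Finset.mem_filter, Finset.mem_univ, true_and,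
        Finset.mem_Ico] at hq h ⊢
      intro u hu
      rcases hq with hq | hq
      · exact hq u ⟨by omega, hu.2⟩
      · rw [h u hu]
        exact hq u ⟨by omega, hu.2⟩
    · rw [Finset.disjoint_left]
      intro q h₁ h₂
      simp only [Finset.mem_filter, Finset.mem_univ, true_and, Finset.mem_Ico] at h₁ h₂
      exact hne ((h₁ k ⟨le_rfl, hk⟩).symm.trans (h₂ k ⟨le_rfl, hk⟩))
  have := agreeCount_congr h
  omega

/-- A positive nondecreasing sequence doubles at most logarithmically often. -/
lemma two_pow_card_doublings_le (c : ℕ → ℕ) (h0 : 0 < c 0) (hc : ∀ k, c k ≤ c (k + 1)) (l : ℕ) :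
    2 ^ ((Finset.range l).filter fun k => 2 * c k ≤ c (k + 1)).card ≤ c l := by
  induction l with
  | zero => simpa [Nat.one_le_iff_ne_zero, Nat.pos_iff_ne_zero] using h0
  | succ l ih =>
    rw [Finset.range_add_one, Finset.filter_insert]
    split_ifs with h
    · rw [Finset.card_insert_of_notMem (by simp), pow_succ]
      omega
    · exact ih.trans (hc l)

/-- The adjacent pairs in an enumeration `p` of cyclic positions whose preceding letters differ
and whose common prefix has length in `[l, 2l)`. -/
def dyadicBreaks [DecidableEq α] {n : ℕ} (T : ZMod n → α) (p : ℕ → ZMod n) (l : ℕ) : Finset ℕ :=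
  (Finset.range (n - 1)).filter fun i =>
    T (p i - 1) ≠ T (p (i + 1) - 1) ∧
      cyclicWindow T (p i) l = cyclicWindow T (p (i + 1)) l ∧
      cyclicWindow T (p i) (2 * l) ≠ cyclicWindow T (p (i + 1)) (2 * l)

lemma dyadicBreaks_card_le [DecidableEq α] {n : ℕ} [NeZero n] (T : ZMod n → α) (p : ℕ → ZMod n)
    (hsq : ∀ i j k, i ≤ j → j ≤ k → k < n → ∀ m,
      cyclicWindow T (p i) m = cyclicWindow T (p k) m →
      cyclicWindow T (p i) m = cyclicWindow T (p j) m) (l : ℕ) :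
    (dyadicBreaks T p l).card * l ≤
      (2 * Nat.log 2 n) * (Finset.univ.image fun z => cyclicWindow T z (3 * l)).card := by
  classical
  let st (i k : ℕ) : ZMod n := p i - ((k + 1 : ℕ) : ZMod n)
  have st_add (i k s : ℕ) : st i k + ((k + 1 + s : ℕ) : ZMod n) = p i + s := by
    simp only [st]; push_cast; ring
  have st_pred (i k : ℕ) : st i k + (k : ZMod n) = p i - 1 := by
    simp only [st]; push_cast; ring
  let light (z : ZMod n) (k : ℕ) : Prop := 2 * agreeCount T z l k ≤ agreeCount T z l (k + 1)
  let g : ℕ × ℕ → ZMod n := fun x => if light (st x.1 x.2) x.2 then st x.1 x.2 else st (x.1 + 1) x.2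
  have hwin : ∀ i i' k, k < l → cyclicWindow T (st i k) (3 * l) = cyclicWindow T (st i' k) (3 * l) →
      cyclicWindow T (p i) (2 * l) = cyclicWindow T (p i') (2 * l) := by
    intro i i' k hk h
    rw [cyclicWindow_eq_iff] at h ⊢
    intro s hs
    rw [← st_add i k, ← st_add i' k]
    exact h _ (by omega)
  have hlight : ∀ x ∈ dyadicBreaks T p l ×ˢ Finset.range l, light (g x) x.2 := by
    rintro ⟨i, k⟩ hx
    simp only [Finset.mem_product, dyadicBreaks, Finset.mem_filter, Finset.mem_range] at hx
    obtain ⟨⟨-, hne, heq, -⟩, hk⟩ := hx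
    simp only [g]
    split_ifs with h
    · exact h
    · refine (two_mul_agreeCount_le_or (a := st i k) hk ?_ ?_).resolve_left h
      · rw [st_pred, st_pred]; exact hne
      · intro u hu
        obtain ⟨h₁, h₂⟩ := Finset.mem_Ico.mp hu
        obtain ⟨s, rfl⟩ := Nat.exists_eq_add_of_le h₁
        rw [st_add, st_add]
        exact cyclicWindow_eq_iff.mp heq s (by omega)
  rw [← Finset.card_range l, ← Finset.card_product, Finset.card_range]
  refine Finset.card_le_mul_card_image_of_maps_to (f := fun x => cyclicWindow T (g x) (3 * l))
    (fun x _ => Finset.mem_image_of_mem _ (Finset.mem_univ _)) _ ?_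
  intro b hb
  obtain ⟨z, -, rfl⟩ := Finset.mem_image.mp hb
  have hcount : ((Finset.range l).filter fun k => light z k).card ≤ Nat.log 2 n := by
    refine Nat.le_log_of_pow_le (by norm_num) ?_
    exact (two_pow_card_doublings_le _ (agreeCount_pos T z l 0) (agreeCount_mono T z l) l).trans
      (agreeCount_le T z l l)
  have hprod : ((Finset.univ : Finset Bool) ×ˢ (Finset.range l).filter fun k => light z k).card
      ≤ 2 * Nat.log 2 n := by
    rw [Finset.card_product, Finset.card_univ, Fintype.card_bool]
    omega
  refine le_trans ?_ hprod
  refine Finset.card_le_card_of_injOn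
    (fun x => (decide (light (st x.1 x.2) x.2), x.2)) ?_ ?_
  · intro x hx
    simp only [Finset.coe_filter, Set.mem_ofPred_eq] at hx
    obtain ⟨hx, hz⟩ := hx
    have h := hlight x hx
    have hk : x.2 < l := Finset.mem_range.mp (Finset.mem_product.mp hx).2
    simp only [Finset.coe_product, Set.mem_prod, Finset.coe_univ, Set.mem_univ, true_and,
      Finset.coe_filter, Set.mem_ofPred_eq, Finset.mem_range]
    refine ⟨hk, ?_⟩
    have hc : ∀ k', agreeCount T (g x) l k' = agreeCount T z l k' := fun k' =>
      agreeCount_congr fun u hu => cyclicWindow_eq_iff.mp hz u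
        (by have := (Finset.mem_Ico.mp hu).2; omega)
    simpa only [light, hc] using h
  · have key : ∀ i i' k, i ∈ dyadicBreaks T p l → i' ∈ dyadicBreaks T p l → k < l →
        (light (st i k) k ↔ light (st i' k) k) →
        cyclicWindow T (g (i, k)) (3 * l) = cyclicWindow T (g (i', k)) (3 * l) → ¬ i < i' := by
      intro i i' k hi hi' hk hiff hg hlt
      simp only [dyadicBreaks, Finset.mem_filter, Finset.mem_range] at hi hi'
      simp only [g] at hg
      by_cases h : light (st i k) k
      · rw [if_pos h, if_pos (hiff.mp h)] at hg
        exact hi.2.2.2 (hsq i (i + 1) i' (by omega) hlt (by omega) _ (hwin _ _ _ hk hg))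
      · rw [if_neg h, if_neg (hiff.not.mp h)] at hg
        have h₁ := hwin _ _ _ hk hg
        have h₂ := hsq (i + 1) i' (i' + 1) hlt (by omega) (by omega) _ h₁
        exact hi'.2.2.2 (h₂.symm.trans h₁)
    rintro ⟨i, k⟩ hx ⟨i', k'⟩ hx' hxx
    simp only [Finset.coe_filter, Set.mem_ofPred_eq, Finset.mem_product, Finset.mem_range]
      at hx hx'
    simp only [Prod.mk.injEq, decide_eq_decide] at hxx
    obtain ⟨hiff, rfl⟩ := hxx
    have h₁ := key i i' k hx.1.1 hx'.1.1 hx.1.2 hiff (hx.2.trans hx'.2.symm)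
    have h₂ := key i' i k hx'.1.1 hx.1.1 hx.1.2 hiff.symm (hx'.2.trans hx.2.symm)
    rw [Prod.mk.injEq]
    exact ⟨by omega, rfl⟩

lemma cyclicWindow_extend {n : ℕ} [NeZero n] {T : ZMod n → α} {a b : ZMod n}
    (h : cyclicWindow T a n = cyclicWindow T b n) (m' : ℕ) :
    cyclicWindow T a m' = cyclicWindow T b m' := by
  rw [cyclicWindow_eq_iff] at h ⊢
  intro s _
  have := h (s % n) (Nat.mod_lt _ (NeZero.pos n))
  simpa using this

lemma cyclicWindow_of_le {n : ℕ} {T : ZMod n → α} {a b : ZMod n} {m m' : ℕ}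
    (hm : m ≤ m') (h : cyclicWindow T a m' = cyclicWindow T b m') :
    cyclicWindow T a m = cyclicWindow T b m := by
  rw [cyclicWindow_eq_iff] at h ⊢
  exact fun s hs => h s (by omega)

/-- Every adjacent pair whose preceding letters differ has a first mismatch, either at once or
at some dyadic scale. -/
lemma card_breaks_le [DecidableEq α] {n : ℕ} [NeZero n] (T : ZMod n → α) (p : ℕ → ZMod n)
    (hsq : ∀ i j k, i ≤ j → j ≤ k → k < n → ∀ m,
      cyclicWindow T (p i) m = cyclicWindow T (p k) m →
      cyclicWindow T (p i) m = cyclicWindow T (p j) m) (M : ℕ) (hM : n ≤ 2 ^ M) :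
    ((Finset.range (n - 1)).filter fun i => T (p i - 1) ≠ T (p (i + 1) - 1)).card ≤
      (Finset.univ.image fun z => cyclicWindow T z 1).card +
        ∑ m ∈ Finset.range M, (dyadicBreaks T p (2 ^ m)).card := by
  classical
  let E₀ := (Finset.range (n - 1)).filter fun i =>
    cyclicWindow T (p i) 1 ≠ cyclicWindow T (p (i + 1)) 1
  have hE₀ : E₀.card ≤ (Finset.univ.image fun z => cyclicWindow T z 1).card := by
    refine Finset.card_le_card_of_injOn (fun i => cyclicWindow T (p i) 1)
      (fun i _ => by simp) ?_
    have key : ∀ i ∈ E₀, ∀ i' ∈ E₀,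
        cyclicWindow T (p i) 1 = cyclicWindow T (p i') 1 → ¬ i < i' := by
      intro i hi i' hi' h hlt
      simp only [E₀, Finset.mem_filter, Finset.mem_range] at hi hi'
      exact hi.2 (hsq i (i + 1) i' (by omega) hlt (by omega) 1 h)
    intro i hi i' hi' h
    have h₁ := key i hi i' hi' h
    have h₂ := key i' hi' i hi h.symm
    omega
  have hsub : ((Finset.range (n - 1)).filter fun i => T (p i - 1) ≠ T (p (i + 1) - 1)) ⊆
      E₀ ∪ (Finset.range M).biUnion fun m => dyadicBreaks T p (2 ^ m) := by
    intro i hi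
    simp only [Finset.mem_filter, Finset.mem_range] at hi
    simp only [Finset.mem_union, Finset.mem_biUnion, E₀, dyadicBreaks, Finset.mem_filter,
      Finset.mem_range]
    by_cases h1 : cyclicWindow T (p i) 1 = cyclicWindow T (p (i + 1)) 1
    · right
      by_contra! hcon
      have hall : ∀ m ≤ M,
          cyclicWindow T (p i) (2 ^ m) = cyclicWindow T (p (i + 1)) (2 ^ m) := by
        intro m
        induction m with
        | zero => intro _; simpa using h1
        | succ m ih =>
          intro hm
          have := hcon m (by omega) hi.1 hi.2 (ih (by omega))
          rwa [pow_succ']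
      have hn := cyclicWindow_of_le hM (hall M le_rfl)
      have hlast := cyclicWindow_eq_iff.mp hn (n - 1) (by omega)
      rw [Nat.cast_sub (NeZero.one_le)] at hlast
      simp only [CharP.cast_eq_zero, Nat.cast_one, zero_sub, ← sub_eq_add_neg] at hlast
      exact hi.2 hlast
    · exact Or.inl ⟨hi.1, h1⟩
  refine (Finset.card_le_card hsub).trans ((Finset.card_union_le _ _).trans ?_)
  exact Nat.add_le_add hE₀ Finset.card_biUnion_le

lemma le_foldr_max {l : List ℚ} {x : ℚ} (hx : x ∈ l) : x ≤ l.foldr max 0 := by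
  induction l with
  | nil => simp at hx
  | cons a l ih =>
    rcases List.mem_cons.mp hx with rfl | h
    · exact le_max_left _ _
    · exact (ih h).trans (le_max_right _ _)

lemma foldr_max_le {l : List ℚ} {B : ℚ} (hB : 0 ≤ B) (h : ∀ x ∈ l, x ≤ B) :
    l.foldr max 0 ≤ B := by
  induction l with
  | nil => simpa using hB
  | cons a l ih =>
    exact max_le (h a (by simp)) (ih fun x hx => h x (by simp [hx]))

lemma numDistinctSubstr_eq_card [DecidableEq α] (w : List α) (k : ℕ) :
    numDistinctSubstr w k =
      ((Finset.range (w.length - k + 1)).image fun i => (w.drop i).take k).card := by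
  rw [numDistinctSubstr, ← List.card_toFinset]
  congr 1

lemma numDistinctSubstr_le_mul_deltaQ [DecidableEq α] (w : List α) {k : ℕ} (hk : 1 ≤ k)
    (hkn : k ≤ w.length) : (numDistinctSubstr w k : ℚ) ≤ k * deltaQ w := by
  obtain ⟨k, rfl⟩ := Nat.exists_eq_add_of_le' hk
  have h : (numDistinctSubstr w (k + 1) : ℚ) / ((k : ℚ) + 1) ≤ deltaQ w :=
    le_foldr_max (List.mem_map.mpr ⟨k, List.mem_range.mpr (by omega), rfl⟩)
  rw [div_le_iff₀ (by positivity)] at h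
  push_cast
  linarith

lemma deltaQ_le [DecidableEq α] (w : List α) {B : ℚ} (hB : 0 ≤ B)
    (h : ∀ k, 1 ≤ k → k ≤ w.length → (numDistinctSubstr w k : ℚ) ≤ B * k) : deltaQ w ≤ B := by
  refine foldr_max_le hB fun x hx => ?_
  obtain ⟨k, hk, rfl⟩ := List.mem_map.mp hx
  rw [div_le_iff₀ (by positivity)]
  exact_mod_cast h (k + 1) (by omega) (by have := List.mem_range.mp hk; omega)

lemma one_le_deltaQ [DecidableEq α] {w : List α} (hw : 1 ≤ w.length) : 1 ≤ deltaQ w := by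
  have h := numDistinctSubstr_le_mul_deltaQ w le_rfl hw
  have h1 : 1 ≤ numDistinctSubstr w 1 := by
    rw [numDistinctSubstr_eq_card]
    exact Finset.card_pos.mpr (Finset.image_nonempty.mpr ⟨0, by simp⟩)
  have h1' : (1 : ℚ) ≤ numDistinctSubstr w 1 := by exact_mod_cast h1
  push_cast at h
  linarith

/-- The number of distinct windows of a sequence is controlled by its number of breaks. -/
lemma card_windows_le_breaks [DecidableEq α] (f : ℕ → α) {n k : ℕ} (hk : 1 ≤ k) (hkn : k ≤ n) :
    ((Finset.range (n - k + 1)).image fun i => (List.range k).map fun t => f (i + t)).card ≤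
      ((Finset.range (n - 1)).filter fun i => f i ≠ f (i + 1)).card * k + 1 := by
  classical
  set E := (Finset.range (n - 1)).filter fun i => f i ≠ f (i + 1) with hE
  have hfirst : ∀ i < n, f i = f 0 ∨ ∃ e ∈ E, f i = f (e + 1) := by
    intro i
    induction i with
    | zero => intro _; exact Or.inl rfl
    | succ i ih =>
      intro hi
      by_cases h : f i = f (i + 1)
      · rw [← h]; exact ih (by omega)
      · exact Or.inr ⟨i, Finset.mem_filter.mpr ⟨Finset.mem_range.mpr (by omega), h⟩, rfl⟩
  have hsub : ((Finset.range (n - k + 1)).image fun i => (List.range k).map fun t => f (i + t)) ⊆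
      insert ((List.range k).map fun _ => f 0) ((E ×ˢ Finset.range k).image fun x =>
        (List.range k).map fun t => if x.2 + 1 = k then f (x.1 + 1) else f (x.1 - x.2 + t)) := by
    intro x hx
    obtain ⟨i, hi, rfl⟩ := Finset.mem_image.mp hx
    have hi := Finset.mem_range.mp hi
    simp only [Finset.mem_insert, Finset.mem_image, Finset.mem_product, Finset.mem_range,
      Prod.exists]
    by_cases hex : ∃ e ∈ E, i ≤ e ∧ e + 1 < i + k
    · obtain ⟨e, he, hie, hek⟩ := hex
      refine Or.inr ⟨e, e - i, ⟨he, by omega⟩, ?_⟩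
      rw [List.map_inj_left]
      intro t _
      rw [if_neg (by omega), show e - (e - i) = i by omega]
    · push Not at hex
      have hconst : ∀ t < k, f (i + t) = f i := by
        intro t
        induction t with
        | zero => intro _; rfl
        | succ t ih =>
          intro ht
          rw [← ih (by omega)]
          by_contra hne
          have hmem : i + t ∈ E := by
            simp only [hE, Finset.mem_filter, Finset.mem_range]
            exact ⟨by omega, fun h => hne h.symm⟩
          have := hex _ hmem (by omega)
          omega
      rcases hfirst i (by omega) with h | ⟨e, he, h⟩
      · left
        rw [List.map_inj_left]
        intro t ht
        rw [hconst t (List.mem_range.mp ht), h]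
      · refine Or.inr ⟨e, k - 1, ⟨he, by omega⟩, ?_⟩
        rw [List.map_inj_left]
        intro t ht
        rw [if_pos (by omega), hconst t (List.mem_range.mp ht), h]
  calc _ ≤ _ := Finset.card_le_card hsub
    _ ≤ _ := Finset.card_insert_le _ _
    _ ≤ _ := by
      gcongr
      refine Finset.card_image_le.trans ?_
      rw [Finset.card_product, Finset.card_range]

lemma deltaQ_map_range_le [DecidableEq α] (f : ℕ → α) (n : ℕ) :
    deltaQ ((List.range n).map f) ≤
      ((Finset.range (n - 1)).filter fun i => f i ≠ f (i + 1)).card + 1 := by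
  refine deltaQ_le _ (by positivity) fun k hk hkn => ?_
  rw [List.length_map, List.length_range] at hkn
  have h := card_windows_le_breaks f hk hkn
  have heq : numDistinctSubstr ((List.range n).map f) k =
      ((Finset.range (n - k + 1)).image fun i => (List.range k).map fun t => f (i + t)).card := by
    rw [numDistinctSubstr_eq_card, List.length_map, List.length_range]
    congr 1
    refine Finset.image_congr fun i hi => ?_
    have hi : i < n - k + 1 := by simpa using hi
    refine List.ext_getElem (by simp; omega) fun t _ _ => ?_
    simp
  rw [heq]
  have h' : _ ≤ ((_ : ℕ) : ℚ) := Nat.cast_le.mpr h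
  refine h'.trans ?_
  push_cast
  have hk' : (1 : ℚ) ≤ k := by exact_mod_cast hk
  rw [add_mul]
  linarith

/-- A word read cyclically. -/
def cyclicLetter (w : List α) (hw : w ≠ []) (z : ZMod w.length) : α :=
  w[z.val]'(haveI : NeZero w.length := ⟨by simpa using hw⟩; z.val_lt)

lemma cyclicWindow_cyclicLetter {w : List α} (hw : w ≠ []) {i k : ℕ} (h : i + k ≤ w.length) :
    cyclicWindow (cyclicLetter w hw) (i : ZMod w.length) k = (w.drop i).take k := by
  refine List.ext_getElem (by simp [cyclicWindow]; omega) fun t h₁ h₂ => ?_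
  have ht : t < k := by simpa [cyclicWindow] using h₁
  simp only [cyclicWindow, cyclicLetter, List.getElem_map, List.getElem_range, List.getElem_take,
    List.getElem_drop, ← Nat.cast_add, ZMod.val_natCast]
  congr 1
  exact Nat.mod_eq_of_lt (by omega)

lemma rotate_eq_cyclicWindow {w : List α} (hw : w ≠ []) (i : ℕ) :
    w.rotate i = cyclicWindow (cyclicLetter w hw) (i : ZMod w.length) w.length := by
  refine List.ext_getElem (by simp [cyclicWindow]) fun t h₁ h₂ => ?_
  simp [cyclicWindow, cyclicLetter, List.getElem_rotate, ← Nat.cast_add, ZMod.val_natCast, add_comm]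

lemma card_cyclicWindow_le [DecidableEq α] {w : List α} (hw : w ≠ []) [NeZero w.length] {k : ℕ}
    (hk : 1 ≤ k) :
    ((Finset.univ.image fun z => cyclicWindow (cyclicLetter w hw) z k).card : ℚ) ≤
      2 * k * deltaQ w := by
  have hδ := one_le_deltaQ (NeZero.one_le : 1 ≤ w.length)
  have hk' : (1 : ℚ) ≤ k := by exact_mod_cast hk
  have hkδ : (k : ℚ) ≤ k * deltaQ w := le_mul_of_one_le_right (by positivity) hδ
  rcases le_or_gt k w.length with hkn | hkn
  · have hsub : (Finset.univ.image fun z => cyclicWindow (cyclicLetter w hw) z k) ⊆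
        ((Finset.range (w.length - k + 1)).image fun i => (w.drop i).take k) ∪
        ((Finset.Ico (w.length - k + 1) w.length).image fun i : ℕ =>
          cyclicWindow (cyclicLetter w hw) (i : ZMod w.length) k) := by
      intro x hx
      obtain ⟨z, -, rfl⟩ := Finset.mem_image.mp hx
      have hz := z.val_lt
      rw [Finset.mem_union, Finset.mem_image, Finset.mem_image]
      rcases lt_or_ge z.val (w.length - k + 1) with h | h
      · refine Or.inl ⟨z.val, Finset.mem_range.mpr h, ?_⟩
        rw [← cyclicWindow_cyclicLetter hw (by omega), ZMod.natCast_zmod_val]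
      · exact Or.inr ⟨z.val, Finset.mem_Ico.mpr ⟨h, hz⟩, by rw [ZMod.natCast_zmod_val]⟩
    have hcard := (Finset.card_le_card hsub).trans (Finset.card_union_le _ _)
    rw [← numDistinctSubstr_eq_card] at hcard
    have hIco : ((Finset.Ico (w.length - k + 1) w.length).image fun i : ℕ =>
        cyclicWindow (cyclicLetter w hw) (i : ZMod w.length) k).card ≤ k := by
      refine Finset.card_image_le.trans ?_
      rw [Nat.card_Ico]
      omega
    have hcast : ((Finset.univ.image fun z => cyclicWindow (cyclicLetter w hw) z k).card : ℚ) ≤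
        numDistinctSubstr w k + k := by exact_mod_cast hcard.trans (by gcongr)
    have := numDistinctSubstr_le_mul_deltaQ w hk hkn
    linarith
  · have h : (Finset.univ.image fun z => cyclicWindow (cyclicLetter w hw) z k).card ≤ k :=
      Finset.card_image_le.trans (by rw [Finset.card_univ, ZMod.card]; omega)
    have h' : ((Finset.univ.image fun z => cyclicWindow (cyclicLetter w hw) z k).card : ℚ) ≤ k := by
      exact_mod_cast h
    linarith

lemma List.take_le_take_of_le [LinearOrder α] {a b : List α} (h : a ≤ b) (m : ℕ) :
    a.take m ≤ b.take m := by
  induction m generalizing a b with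
  | zero => simp
  | succ m ih =>
    cases a with
    | nil => exact le_of_not_gt (by simp)
    | cons x a =>
      cases b with
      | nil => exact absurd h (not_le_of_gt (by simp))
      | cons y b =>
        rw [List.take_succ_cons, List.take_succ_cons]
        rcases h.lt_or_eq with hlt | heq
        · rcases List.cons_lt_cons_iff.mp hlt with hxy | ⟨rfl, hab⟩
          · exact le_of_lt (List.cons_lt_cons_iff.mpr (Or.inl hxy))
          · exact List.cons_le_cons _ (ih (le_of_lt hab))
        · obtain ⟨rfl, rfl⟩ := List.cons.inj heq
          exact le_rfl

lemma List.take_eq_of_le_of_le [LinearOrder α] {a b c : List α} {m : ℕ} (hab : a ≤ b) (hbc : b ≤ c)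
    (h : a.take m = c.take m) : a.take m = b.take m :=
  le_antisymm (List.take_le_take_of_le hab m) (h ▸ List.take_le_take_of_le hbc m)

lemma cyclicWindow_squeeze [LinearOrder α] {n : ℕ} [NeZero n] {T : ZMod n → α} {a b c : ZMod n}
    (hab : cyclicWindow T a n ≤ cyclicWindow T b n) (hbc : cyclicWindow T b n ≤ cyclicWindow T c n)
    {m : ℕ} (h : cyclicWindow T a m = cyclicWindow T c m) :
    cyclicWindow T a m = cyclicWindow T b m := by
  have htake : ∀ z m, m ≤ n → (cyclicWindow T z n).take m = cyclicWindow T z m := by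
    intro z m hm
    rw [cyclicWindow, ← List.map_take, List.take_range, min_eq_left hm, cyclicWindow]
  rcases le_total m n with hm | hm
  · rw [← htake a m hm, ← htake b m hm]
    refine List.take_eq_of_le_of_le hab hbc ?_
    rw [htake a m hm, htake c m hm, h]
  · have := cyclicWindow_of_le hm h
    exact cyclicWindow_extend (le_antisymm hab (this ▸ hbc)) m

lemma rot_iterate (w : List α) (i : ℕ) : rot^[i] w = w.rotate i := by
  have h1 : ∀ x : List α, rot x = x.rotate 1 := by
    rintro (_ | ⟨a, x⟩) <;> simp [rot]
  induction i with
  | zero => simp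
  | succ i ih => rw [Function.iterate_succ_apply', ih, h1, List.rotate_rotate]

/-- The Burrows–Wheeler transform through an enumeration of the sorted rotations. -/
lemma exists_sorted_enumeration [LinearOrder α] {w : List α} (hw : w ≠ []) :
    ∃ p : ℕ → ZMod w.length,
      (∀ i j, i ≤ j → j < w.length →
        cyclicWindow (cyclicLetter w hw) (p i) w.length ≤
          cyclicWindow (cyclicLetter w hw) (p j) w.length) ∧
      BWT w = (List.range w.length).map fun i => cyclicLetter w hw (p i - 1) := by
  set R := List.insertionSort (· ≤ ·) (rotations w) with hR
  have hlen : R.length = w.length := by simp [hR, rotations]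
  have hmem : ∀ i, ∃ z : ZMod w.length, ∀ h : i < R.length,
      R[i] = cyclicWindow (cyclicLetter w hw) z w.length := by
    intro i
    by_cases h : i < R.length
    · have h' : R[i] ∈ rotations w := (List.mem_insertionSort _).mp (List.getElem_mem h)
      obtain ⟨q, -, hq⟩ := List.mem_map.mp h'
      refine ⟨q, fun _ => ?_⟩
      rw [← hq, rot_iterate, rotate_eq_cyclicWindow hw]
    · exact ⟨0, fun h' => absurd h' h⟩
  choose p hp using hmem
  refine ⟨p, fun i j hij hj => ?_, ?_⟩
  · rcases hij.eq_or_lt with rfl | hlt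
    · exact le_rfl
    · rw [← hp i (by omega), ← hp j (by omega)]
      exact List.pairwise_iff_getElem.mp
        (List.pairwise_insertionSort (· ≤ ·) (rotations w)) i j _ _ hlt
  · have hRmap : R = (List.range w.length).map fun i =>
        cyclicWindow (cyclicLetter w hw) (p i) w.length := by
      refine List.ext_getElem (by simpa using hlen) fun i h₁ h₂ => ?_
      rw [hp i h₁]
      simp
    have hlast : ∀ z, (cyclicWindow (cyclicLetter w hw) z w.length).getLast? =
        some (cyclicLetter w hw (z - 1)) := by
      intro z
      have hpos := List.length_pos_of_ne_nil hw
      rw [cyclicWindow, List.getLast?_map, List.getLast?_range, if_neg (by omega),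
        Option.map_some, Nat.cast_sub hpos]
      simp [sub_eq_add_neg]
    rw [BWT, ← hR, hRmap, List.filterMap_map]
    simp only [Function.comp_def, hlast]
    rw [List.filterMap_eq_map']

/-- there is a constant `C > 0` such that for every string `w` of
length `n ≥ 2`, `δ(BWT(w)) ≤ C · δ(w) · (log₂ n)²`. -/
theorem stmt13 :
    ∃ C : ℝ, 0 < C ∧
      ∀ (β : Type) [LinearOrder β] (w : List β), 2 ≤ w.length →
        ((deltaQ (BWT w) : ℚ) : ℝ) ≤
          C * ((deltaQ w : ℚ) : ℝ) * (Real.logb 2 (w.length : ℝ)) ^ 2 := by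
  refine ⟨27, by norm_num, fun β _ w hw => ?_⟩
  have hne : w ≠ [] := List.ne_nil_of_length_pos (by omega)
  have : NeZero w.length := ⟨by omega⟩
  obtain ⟨p, hmono, hB⟩ := exists_sorted_enumeration hne
  set T := cyclicLetter w hne with hT
  have hsq : ∀ i j k, i ≤ j → j ≤ k → k < w.length → ∀ m,
      cyclicWindow T (p i) m = cyclicWindow T (p k) m →
      cyclicWindow T (p i) m = cyclicWindow T (p j) m := fun i j k hij hjk hk m h =>
    cyclicWindow_squeeze (hmono i j hij (by omega)) (hmono j k hjk hk) h
  have hδ : (1 : ℚ) ≤ deltaQ w := one_le_deltaQ (by omega)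
  set g := Nat.log 2 w.length with hg
  have hrun := deltaQ_map_range_le (fun i => T (p i - 1)) w.length
  rw [← hB] at hrun
  have hbreaks := card_breaks_le T p hsq (g + 1) (Nat.lt_pow_succ_log_self (by norm_num) _).le
  have hone := card_cyclicWindow_le hne (k := 1) le_rfl
  have hdyadic : ∀ m, ((dyadicBreaks T p (2 ^ m)).card : ℚ) ≤ 12 * g * deltaQ w := by
    intro m
    have h₁ := dyadicBreaks_card_le T p hsq (2 ^ m)
    have h₂ := card_cyclicWindow_le hne (k := 3 * 2 ^ m) (by have := Nat.one_le_two_pow (n := m); omega)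
    have h₁' : ((dyadicBreaks T p (2 ^ m)).card : ℚ) * 2 ^ m ≤ 2 * g *
        (Finset.univ.image fun z => cyclicWindow T z (3 * 2 ^ m)).card := by exact_mod_cast h₁
    have hpos : (0 : ℚ) < 2 ^ m := by positivity
    refine le_of_mul_le_mul_right (h₁'.trans ?_) hpos
    calc _ ≤ 2 * (g : ℚ) * (2 * ((3 * 2 ^ m : ℕ) : ℚ) * deltaQ w) := by gcongr
      _ = _ := by push_cast; ring
  have hsum : (∑ m ∈ Finset.range (g + 1), ((dyadicBreaks T p (2 ^ m)).card : ℚ)) ≤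
      (g + 1) * (12 * g * deltaQ w) := by
    refine (Finset.sum_le_sum fun m _ => hdyadic m).trans ?_
    simp
  have hbreaks' : (((Finset.range (w.length - 1)).filter fun i =>
      T (p i - 1) ≠ T (p (i + 1) - 1)).card : ℚ) ≤
      (Finset.univ.image fun z => cyclicWindow T z 1).card +
        ∑ m ∈ Finset.range (g + 1), ((dyadicBreaks T p (2 ^ m)).card : ℚ) := by
    exact_mod_cast hbreaks
  have hg1 : (1 : ℚ) ≤ g := by exact_mod_cast Nat.log_pos (by norm_num) hw
  have htotal : deltaQ (BWT w) ≤ 27 * deltaQ w * (g : ℚ) ^ 2 := by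
    have hgg : (1 : ℚ) ≤ (g : ℚ) ^ 2 := one_le_pow₀ hg1
    have h₁ : deltaQ w ≤ deltaQ w * (g : ℚ) ^ 2 := le_mul_of_one_le_right (by linarith) hgg
    have h₂ : deltaQ w * g ≤ deltaQ w * (g : ℚ) ^ 2 := by
      gcongr
      exact le_self_pow₀ hg1 (by norm_num)
    push_cast at hone
    linarith
  have hlog : (g : ℝ) ≤ Real.logb 2 w.length := by
    exact_mod_cast Real.natLog_le_logb w.length 2
  have htotal' : ((deltaQ (BWT w) : ℚ) : ℝ) ≤ 27 * (deltaQ w : ℚ) * (g : ℝ) ^ 2 := by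
    exact_mod_cast htotal
  have hδ' : (0 : ℝ) ≤ (deltaQ w : ℚ) := by
    exact_mod_cast zero_le_one.trans hδ
  refine htotal'.trans ?_
  gcongr
end

section
/- For every integer i ≥ 0, letting k be the smallest integer with i < f_k, the length-i prefix of the infinite Fibonacci word satisfies F_∞[0..i) = F_{k-1}^{Z(i)[k-2]} · F_{k-2}^{Z(i)[k-3]} · ⋯ · F_1^{Z(i)[0]}, i.e., the concatenation of the words F_{j+1}^{Z(i)[j]} for j = k-2 down to 0 in decreasing order of j. -/
/-! Basic definitions: strings as `List α`, rotations, runs, BWT, Lyndon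
factorization, ω-order, bijective BWT, and Fibonacci words. -/

variable {α : Type*}

theorem fibWord_add_two (n : ℕ) : fibWord (n + 2) = fibWord (n + 1) ++ fibWord n := rfl

theorem fibWord_length_pos (n : ℕ) : 0 < (fibWord n).length := by
  induction n using Nat.twoStepInduction with
  | zero => simp [fibWord, fibWordG]
  | one => simp [fibWord, fibWordG]
  | more n _ h => simp only [fibWord_add_two, List.length_append]; omega

theorem fibWord_length_monotone : Monotone fun n => (fibWord n).length := by
  refine monotone_nat_of_le_succ fun n => ?_
  cases n with
  | zero => simp [fibWord, fibWordG]
  | succ n => simp [fibWord_add_two]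

theorem le_fibWord_length (n : ℕ) : n ≤ (fibWord n).length := by
  induction n using Nat.twoStepInduction with
  | zero => simp
  | one => simp [fibWord, fibWordG]
  | more n _ h =>
    have := fibWord_length_pos n
    simp only [fibWord_add_two, List.length_append]
    omega

theorem fibWord_succ_isPrefix_of_le {m n : ℕ} (h : m ≤ n) : fibWord (m + 1) <+: fibWord (n + 1) := by
  induction n, h using Nat.le_induction with
  | base => exact List.prefix_rfl
  | succ n _ ih => exact ih.trans (List.prefix_append _ _)

/-- The concatenation of the words `F_{j+1}` over the indices `j ∈ S` below `n`,
in decreasing order of `j`. -/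
def zeckendorfWord (S : Finset ℕ) (n : ℕ) : List (Fin 2) :=
  (((List.range n).reverse).map (fun j => if j ∈ S then fibWord (j + 1) else [])).flatten

theorem zeckendorfWord_succ (S : Finset ℕ) (n : ℕ) :
    zeckendorfWord S (n + 1) = (if n ∈ S then fibWord (n + 1) else []) ++ zeckendorfWord S n := by
  simp [zeckendorfWord, List.range_succ]

theorem zeckendorfWord_length (S : Finset ℕ) (n : ℕ) :
    (zeckendorfWord S n).length =
      ∑ j ∈ Finset.range n, if j ∈ S then (fibWord (j + 1)).length else 0 := by
  induction n with
  | zero => simp [zeckendorfWord]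
  | succ n ih =>
    rw [zeckendorfWord_succ, Finset.sum_range_succ, List.length_append, ih, add_comm]
    split_ifs <;> simp

theorem zeckendorfWord_isPrefix_fibWord {S : Finset ℕ} (hS : ∀ j ∈ S, j + 1 ∉ S) (n : ℕ) :
    zeckendorfWord S n <+: fibWord (n + 1) := by
  induction n using Nat.twoStepInduction with
  | zero => simp [zeckendorfWord]
  | one =>
    rw [zeckendorfWord_succ]
    split_ifs <;> simp [zeckendorfWord, fibWord, fibWordG]
  | more n ih ih' =>
    rw [zeckendorfWord_succ]
    split_ifs with h
    · have hn : n ∉ S := fun hn => hS n hn h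
      rw [zeckendorfWord_succ, if_neg hn, List.nil_append, fibWord_add_two]
      exact (List.prefix_append_right_inj _).2 ih
    · exact ih'.trans (fibWord_succ_isPrefix_of_le (Nat.le_succ _))

/-- for `i ≥ 0`, let `k` be the smallest integer with `i < f_k`
and let `S` (the Zeckendorf representation of `i`) be the unique set of
indices, containing no two consecutive indices, with `i = ∑_{j ∈ S} f_{j+1}`.
Then the length-`i` prefix of the infinite Fibonacci word (realized as
`(F_{i+1}).take i`, since `f_{i+1} ≥ i` and every `F_m`, `m ≥ 1`, is a prefix
of the infinite Fibonacci word) equals the concatenation of the words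
`F_{j+1}^{Z(i)[j]}` for `j = k-2` down to `0`. -/
theorem stmt16 (i k : ℕ) (S : Finset ℕ)
    (hik : i < (fibWord k).length)
    (hkmin : ∀ k' < k, (fibWord k').length ≤ i)
    (hS : ∀ j ∈ S, j + 1 ∉ S)
    (hsum : ∑ j ∈ S, (fibWord (j + 1)).length = i) :
    (fibWord (i + 1)).take i =
      (((List.range (k - 1)).reverse).map
        (fun j => if j ∈ S then fibWord (j + 1) else [])).flatten := by
  have hsub : S ⊆ Finset.range (k - 1) := by
    intro j hj
    have hle : (fibWord (j + 1)).length ≤ i := by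
      rw [← hsum]
      exact Finset.single_le_sum (f := fun j => (fibWord (j + 1)).length)
        (fun _ _ => Nat.zero_le _) hj
    have hlt : j + 1 < k := by
      by_contra! hk
      exact absurd (fibWord_length_monotone hk) (by simpa using hle.trans_lt hik)
    simp only [Finset.mem_range]
    omega
  have hlen : (zeckendorfWord S (k - 1)).length = i := by
    rw [zeckendorfWord_length, ← Finset.sum_filter, Finset.filter_mem_eq_inter,
      Finset.inter_eq_right.2 hsub, hsum]
  have hpre : zeckendorfWord S (k - 1) <+: fibWord (i + 1) := by
    refine List.prefix_of_prefix_length_le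
      ((zeckendorfWord_isPrefix_fibWord hS _).trans (fibWord_succ_isPrefix_of_le (le_max_left (k - 1) i)))
      (fibWord_succ_isPrefix_of_le (le_max_right (k - 1) i)) ?_
    have := le_fibWord_length (i + 1)
    omega
  have := List.prefix_iff_eq_take.1 hpre
  rw [hlen] at this
  exact this.symm
end
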